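/- Suppose 1 < p < ∞, n + 1/p < α < n + 1, γ > n + (p−1)/p, and μ is a positive Borel measure on 𝒰 satisfying ∫_𝒰 |wₙ + i|^{−α₀} dμ(w) < ∞ for some α₀ > 0 and which is a Carleson measure for A¹(𝒰). Then for all f ∈ 𝒮_α and g ∈ 𝒮_γ, ∫_𝒰 ( ∫_𝒰 K(z,w) f(w) dμ(w) ) · conj(g(z)) dV(z) = ∫_𝒰 f(w) conj(g(w)) dμ(w), both sides being absolutely convergent. -/

import Mathlib

open MeasureTheory Filter

noncomputable section

/-- Points of ℂⁿ written `z = (z′, zₙ)` with `z′ ∈ ℂ^m`, `m = n - 1`. -/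
abbrev SPoint (m : ℕ) := (Fin m → ℂ) × ℂ

/-- `ρ(z,w) = (i/2)(w̄ₙ − zₙ) − z′·w̄′`. -/
def srho2 {m : ℕ} (z w : SPoint m) : ℂ :=
  Complex.I / 2 * ((starRingEnd ℂ) w.2 - z.2) - ∑ j, z.1 j * (starRingEnd ℂ) (w.1 j)

/-- `ρ(z) = Im zₙ − |z′|²`. -/
def srho {m : ℕ} (z : SPoint m) : ℝ :=
  z.2.im - ∑ j, ‖z.1 j‖ ^ 2

/-- The Siegel upper half-space `𝒰 = {z : ρ(z) > 0}`. -/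
def Siegel (m : ℕ) : Set (SPoint m) := {z | 0 < srho z}

/-- The Bergman kernel `K(z,w) = (n!/(4πⁿ)) ρ(z,w)^{−(n+1)}` (points in ℂⁿ = ℂ^{n-1} × ℂ). -/
def sK (n : ℕ) (z w : SPoint (n - 1)) : ℂ :=
  (n.factorial : ℂ) / (4 * (Real.pi : ℂ) ^ n) * srho2 z w ^ (-(n + 1 : ℤ))

/-- Inverse hyperbolic tangent. -/
def artanh (x : ℝ) : ℝ := (1 / 2) * Real.log ((1 + x) / (1 - x))

/-- The Bergman distance `β(z,w) = artanh √(1 − ρ(z)ρ(w)/|ρ(z,w)|²)`. -/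
def sbeta {m : ℕ} (z w : SPoint m) : ℝ :=
  artanh (Real.sqrt (1 - srho z * srho w / ‖srho2 z w‖ ^ 2))

/-- The Bergman metric ball `D(z,r)`. -/
def sball {m : ℕ} (z : SPoint m) (r : ℝ) : Set (SPoint m) :=
  {w ∈ Siegel m | sbeta z w < r}

/-- Membership in the Bergman space `Aᵖ(𝒰)`: holomorphic with `∫_𝒰 |f|ᵖ dV < ∞`. -/
def MemAp (n : ℕ) (p : ℝ) (f : SPoint (n - 1) → ℂ) : Prop :=
  DifferentiableOn ℂ f (Siegel (n - 1)) ∧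
    IntegrableOn (fun z => ‖f z‖ ^ p) (Siegel (n - 1)) volume

/-- `‖f‖ₚ = (∫_𝒰 |f|ᵖ dV)^{1/p}`. -/
def bNorm (n : ℕ) (p : ℝ) (f : SPoint (n - 1) → ℂ) : ℝ :=
  (∫ z in Siegel (n - 1), ‖f z‖ ^ p) ^ (1 / p)

/-- The space `𝒮_α` of holomorphic `f` on `𝒰` with `sup_z |zₙ + i|^α |f(z)| < ∞`. -/
def SAlpha (n : ℕ) (α : ℝ) (f : SPoint (n - 1) → ℂ) : Prop :=
  DifferentiableOn ℂ f (Siegel (n - 1)) ∧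
    ∃ M : ℝ, ∀ z ∈ Siegel (n - 1), ‖z.2 + Complex.I‖ ^ α * ‖f z‖ ≤ M

end

/-- **Mean value property** on balanced open sets. -/
theorem setIntegral_mul_eq_of_balanced {E : Type*} [NormedAddCommGroup E] [NormedSpace ℂ E]
    [MeasurableSpace E] [BorelSpace E] [SecondCountableTopology E] {μ : Measure E} [SFinite μ]
    (hμ : ∀ θ : ℝ, MeasurePreserving (fun x : E => Complex.exp (θ * Complex.I) • x) μ μ)
    {S : Set E} (hS : IsOpen S) (hbal : Balanced ℂ S) {F ψ : E → ℂ}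
    (hF : DifferentiableOn ℂ F S)
    (hinv : ∀ (θ : ℝ) (x : E), ψ (Complex.exp (θ * Complex.I) • x) = ψ x)
    (h_int : IntegrableOn (fun x => ψ x * F x) S μ) :
    ∫ x in S, ψ x * F x ∂μ = (∫ x in S, ψ x ∂μ) * F 0 := by
  have hexp : ∀ θ : ℝ, ‖Complex.exp (θ * Complex.I)‖ = 1 := Complex.norm_exp_ofReal_mul_I
  have hpre : ∀ θ : ℝ, (fun x : E => Complex.exp (θ * Complex.I) • x) ⁻¹' S = S := fun θ => by
    ext x
    simpa using hbal.smul_mem_iff (x := x) (b := (1 : ℂ)) (by rw [hexp, norm_one])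
  have hrot : ∀ θ : ℝ, MeasurePreserving (fun x : E => Complex.exp (θ * Complex.I) • x)
      (μ.restrict S) (μ.restrict S) := fun θ => by
    have := (hμ θ).restrict_preimage hS.measurableSet
    rwa [hpre] at this
  set ν : Measure ℝ := volume.restrict (Set.Ioc 0 (2 * Real.pi)) with hν
  have hΦ : MeasurePreserving (fun q : ℝ × E => (q.1, Complex.exp (q.1 * Complex.I) • q.2))
      (ν.prod (μ.restrict S)) (ν.prod (μ.restrict S)) := by
    refine (MeasurePreserving.id ν).skew_product
      (g := fun (θ : ℝ) (x : E) => Complex.exp (θ * Complex.I) • x) ?_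
      (ae_of_all _ fun θ => (hrot θ).map_eq)
    apply Continuous.measurable
    unfold Function.uncurry
    fun_prop
  have hH : Integrable (fun q : ℝ × E => ψ q.2 * F (Complex.exp (q.1 * Complex.I) • q.2))
      (ν.prod (μ.restrict S)) := by
    have h2 := hΦ.integrable_comp_of_integrable (Integrable.comp_snd (μ := ν) h_int)
    refine h2.congr (ae_of_all _ fun q => ?_)
    simp [Function.comp, hinv]
  have hmean : ∀ x ∈ S, ∫ θ, F (Complex.exp ((θ : ℝ) * Complex.I) • x) ∂ν
      = (2 * Real.pi : ℝ) * F 0 := by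
    intro x hx
    have hd : DiffContOnCl ℂ (fun c : ℂ => F (c • x)) (Metric.ball 0 |1|) := by
      apply DifferentiableOn.diffContOnCl_ball (U := (fun c : ℂ => c • x) ⁻¹' S)
      · exact hF.comp (by fun_prop) (fun c hc => hc)
      · intro c hc
        exact hbal.smul_mem (by simpa using hc) hx
    have h3 := hd.circleAverage
    rw [Real.circleAverage, intervalIntegral.integral_of_le (by positivity)] at h3
    simp only [circleMap, zero_add, Complex.ofReal_one, one_mul, zero_smul] at h3
    rw [← h3, Complex.real_smul, ← mul_assoc, ← Complex.ofReal_mul, mul_inv_cancel₀ (by positivity)]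
    simp [hν]
  have hswap := integral_integral_swap
    (f := fun (θ : ℝ) (x : E) => ψ x * F (Complex.exp (θ * Complex.I) • x)) hH
  have hl : ∀ θ : ℝ, ∫ x in S, ψ x * F (Complex.exp (θ * Complex.I) • x) ∂μ
      = ∫ x in S, ψ x * F x ∂μ := fun θ => by
    rcases eq_or_ne (Complex.exp (θ * Complex.I)) 0 with h | h
    · simpa [h] using hexp θ
    have := (hrot θ).integral_comp (Homeomorph.smulOfNeZero _ h).measurableEmbedding
      (fun x => ψ x * F x)
    simpa [hinv] using this
  simp_rw [hl] at hswap
  have hr : ∫ x in S, ∫ θ, ψ x * F (Complex.exp ((θ : ℝ) * Complex.I) • x) ∂ν ∂μ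
      = (2 * Real.pi : ℝ) * ((∫ x in S, ψ x ∂μ) * F 0) := by
    rw [mul_comm, mul_assoc, ← integral_mul_const]
    refine setIntegral_congr_fun hS.measurableSet fun x hx => ?_
    simp only [integral_const_mul]
    rw [hmean x hx]; ring
  rw [hr] at hswap
  have hν1 : ν.real Set.univ = 2 * Real.pi := by
    simp [hν, measureReal_def, Real.pi_pos.le]
  rw [integral_const, hν1, Complex.real_smul] at hswap
  exact mul_left_cancel₀ (by exact_mod_cast (by positivity : (2 * Real.pi : ℝ) ≠ 0)) hswap

theorem volume_sum_sq_norm_lt (m : ℕ) {y : ℝ} (hy : 0 < y) :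
    (volume : Measure (Fin m → ℂ)).real {x | ∑ j, ‖x j‖ ^ 2 < y}
      = Real.pi ^ m * y ^ m / m.factorial := by
  rcases Nat.eq_zero_or_pos m with rfl | hm
  · simp [hy, measureReal_def, volume_pi]
  have : Nonempty (Fin m) := ⟨⟨0, hm⟩⟩
  have h := Complex.volume_sum_rpow_lt (Fin m) (p := 2) one_le_two (Real.sqrt y)
  have hset : {x : Fin m → ℂ | (∑ i, ‖x i‖ ^ (2 : ℝ)) ^ (1 / (2 : ℝ)) < Real.sqrt y}
      = {x | ∑ j, ‖x j‖ ^ 2 < y} := by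
    ext x
    simp only [Real.rpow_two, Set.mem_ofPred_eq, ← Real.sqrt_eq_rpow]
    exact Real.sqrt_lt_sqrt_iff (by positivity)
  rw [hset] at h
  rw [measureReal_def, h, ENNReal.toReal_mul, ENNReal.toReal_pow,
    ENNReal.toReal_ofReal (by positivity), ENNReal.toReal_ofReal (by positivity), Fintype.card_fin,
    pow_mul, Real.sq_sqrt hy.le]
  norm_num
  rw [Real.Gamma_nat_eq_factorial]
  ring

theorem measurePreserving_exp_smul (θ : ℝ) :
    MeasurePreserving (fun x : ℂ => Complex.exp (θ * Complex.I) • x) volume volume := by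
  refine ⟨by fun_prop, ?_⟩
  have h : (fun x : ℂ => Complex.exp (θ * Complex.I) • x)
      = (rotation (Circle.exp θ)).toContinuousLinearEquiv := by
    ext x
    simp [rotation_apply, Circle.coe_exp]
  rw [h]
  exact (LinearIsometryEquiv.measurePreserving (rotation (Circle.exp θ))).map_eq

theorem measurePreserving_exp_smul_pi (m : ℕ) (θ : ℝ) :
    MeasurePreserving (fun x : Fin m → ℂ => Complex.exp (θ * Complex.I) • x) volume volume :=
  volume_preserving_pi (fun _ => measurePreserving_exp_smul θ)

theorem norm_exp_smul {E : Type*} [NormedAddCommGroup E] [NormedSpace ℂ E] (θ : ℝ) (x : E) :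
    ‖Complex.exp (θ * Complex.I) • x‖ = ‖x‖ := by
  rw [norm_smul, Complex.norm_exp_ofReal_mul_I, one_mul]

theorem integral_ball_eq_mul (m : ℕ) {y : ℝ} (hy : 0 < y) {G : (Fin m → ℂ) → ℂ}
    (hG : DifferentiableOn ℂ G {x | ∑ j, ‖x j‖ ^ 2 < y})
    (h_int : IntegrableOn G {x | ∑ j, ‖x j‖ ^ 2 < y}) :
    ∫ x in {x : Fin m → ℂ | ∑ j, ‖x j‖ ^ 2 < y}, G x
      = (Real.pi ^ m * y ^ m / m.factorial : ℝ) * G 0 := by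
  have h := setIntegral_mul_eq_of_balanced (ψ := fun _ => 1) (measurePreserving_exp_smul_pi m)
    (S := {x : Fin m → ℂ | ∑ j, ‖x j‖ ^ 2 < y}) (isOpen_lt (by fun_prop) (by fun_prop)) ?_ hG
    (fun _ _ => rfl) (by simpa using h_int)
  · simp only [one_mul] at h
    rw [h, setIntegral_const, volume_sum_sq_norm_lt m hy, Complex.real_smul, mul_one]
  · intro a ha
    rintro _ ⟨x, hx, rfl⟩
    rw [Set.mem_ofPred_eq] at hx ⊢
    refine lt_of_le_of_lt (Finset.sum_le_sum fun j _ => ?_) hx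
    simp only [Pi.smul_apply, norm_smul]
    have : ‖a‖ * ‖x j‖ ≤ ‖x j‖ := mul_le_of_le_one_left (norm_nonneg _) ha
    gcongr

theorem integral_disc_one_sub_sq_pow (m : ℕ) :
    ∫ z in Metric.ball (0 : ℂ) 1, (((1 - ‖z‖ ^ 2) ^ m : ℝ) : ℂ) = (Real.pi / (m + 1) : ℝ) := by
  rw [integral_complex_ofReal]
  congr 1
  have h1 : ∫ z in Metric.ball (0 : ℂ) 1, (1 - ‖z‖ ^ 2) ^ m
      = ∫ z : ℂ, (Set.Iio (1 : ℝ)).indicator (fun r => (1 - r ^ 2) ^ m) ‖z‖ := by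
    rw [← integral_indicator measurableSet_ball]
    congr 1
    ext z
    simp [Set.indicator]
  rw [h1, integral_fun_norm_addHaar volume]
  simp only [Complex.finrank_real_complex, nsmul_eq_mul, smul_eq_mul, measureReal_def]
  have h2 : ∫ y in Set.Ioi (0 : ℝ), y ^ (2 - 1) * (Set.Iio (1 : ℝ)).indicator
      (fun r => (1 - r ^ 2) ^ m) y = ∫ y in (0 : ℝ)..1, y * (1 - y ^ 2) ^ m := by
    rw [intervalIntegral.integral_of_le zero_le_one, ← integral_Ioc_eq_integral_Ioo.symm,
      ← integral_indicator measurableSet_Ioi, ← integral_indicator measurableSet_Ioo]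
    congr 1
    ext z
    simp only [Set.indicator, Set.mem_Ioi, Set.mem_Iio, Set.mem_Ioo]
    split_ifs <;> first | (exfalso; tauto) | simp_all
  have h3 : ∫ y in (0 : ℝ)..1, y * (1 - y ^ 2) ^ m = 1 / (2 * ((m : ℝ) + 1)) := by
    rw [intervalIntegral.integral_eq_sub_of_hasDerivAt
      (f := fun y : ℝ => -(1 - y ^ 2) ^ (m + 1) / (2 * (m + 1)))]
    · simp; field_simp
    · intro x _
      have := (((hasDerivAt_pow 2 x).const_sub 1).pow (m + 1)).neg.div_const (2 * ((m : ℝ) + 1))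
      refine (this.congr_deriv ?_)
      push_cast; field_simp
    · apply Continuous.intervalIntegrable; fun_prop
  rw [h2, h3]
  simp
  field_simp

theorem integral_disc_mul (m : ℕ) {F : ℂ → ℂ} (hF : DifferentiableOn ℂ F (Metric.ball 0 1))
    (h_int : IntegrableOn (fun z => (((1 - ‖z‖ ^ 2) ^ m : ℝ) : ℂ) * F z) (Metric.ball 0 1)) :
    ∫ z in Metric.ball (0 : ℂ) 1, (((1 - ‖z‖ ^ 2) ^ m : ℝ) : ℂ) * F z
      = (Real.pi / (m + 1) : ℝ) * F 0 := by
  rw [← integral_disc_one_sub_sq_pow]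
  refine setIntegral_mul_eq_of_balanced measurePreserving_exp_smul Metric.isOpen_ball
    ?_ hF (fun θ x => by rw [norm_exp_smul]) h_int
  exact balanced_ball_zero

/-- The Cayley map from the unit disc onto the upper half-plane. -/
noncomputable def cayley (ζ : ℂ) : ℂ := Complex.I * (1 + ζ) / (1 - ζ)

theorem one_sub_ne_zero_of_mem_ball {ζ : ℂ} (hζ : ζ ∈ Metric.ball (0 : ℂ) 1) : 1 - ζ ≠ 0 := by
  intro h
  rw [sub_eq_zero] at h
  simp [← h] at hζ

theorem hasDerivAt_cayley {ζ : ℂ} (hζ : 1 - ζ ≠ 0) :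
    HasDerivAt cayley (2 * Complex.I / (1 - ζ) ^ 2) ζ := by
  have := (((hasDerivAt_id ζ).const_add 1).const_mul Complex.I).div
    ((hasDerivAt_id ζ).const_sub 1) hζ
  refine this.congr_deriv ?_
  simp only [id]
  congr 1
  ring

theorem cayley_im {ζ : ℂ} (hζ : 1 - ζ ≠ 0) :
    (cayley ζ).im = (1 - ‖ζ‖ ^ 2) / ‖1 - ζ‖ ^ 2 := by
  have h0 : Complex.normSq (1 - ζ) ≠ 0 := by simpa [Complex.normSq_eq_zero] using hζ
  rw [cayley, Complex.div_im, ← Complex.normSq_eq_norm_sq, ← Complex.normSq_eq_norm_sq]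
  field_simp
  simp [Complex.normSq_apply]
  ring

theorem conj_cayley_sub_I {ζ : ℂ} (hζ : 1 - ζ ≠ 0) :
    (starRingEnd ℂ) (cayley ζ) - Complex.I = -2 * Complex.I / (starRingEnd ℂ) (1 - ζ) := by
  have h0 : (starRingEnd ℂ) (1 - ζ) ≠ 0 := (map_ne_zero _).2 hζ
  have h1 : 1 - (starRingEnd ℂ) ζ ≠ 0 := by simpa using h0
  simp only [cayley, map_div₀, map_mul, map_add, map_one, Complex.conj_I, map_sub]
  field_simp
  ring

theorem injOn_cayley : Set.InjOn cayley (Metric.ball (0 : ℂ) 1) := by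
  intro a ha b hb h
  have h1 := one_sub_ne_zero_of_mem_ball ha
  have h2 := one_sub_ne_zero_of_mem_ball hb
  rw [cayley, cayley, div_eq_div_iff h1 h2] at h
  have := mul_left_cancel₀ Complex.I_ne_zero (by linear_combination h :
    Complex.I * ((1 + a) * (1 - b)) = Complex.I * ((1 + b) * (1 - a)))
  linear_combination this / 2

theorem image_cayley : cayley '' Metric.ball (0 : ℂ) 1 = {z : ℂ | 0 < z.im} := by
  ext z
  rw [Set.mem_ofPred_eq]
  constructor
  · rintro ⟨ζ, hζ, rfl⟩
    have h1 := one_sub_ne_zero_of_mem_ball hζ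
    rw [cayley_im h1]
    have h2 : ‖ζ‖ < 1 := by simpa using hζ
    have : 0 < ‖1 - ζ‖ := norm_pos_iff.2 h1
    have : 0 < 1 - ‖ζ‖ ^ 2 := by nlinarith [norm_nonneg ζ]
    positivity
  · intro hz
    have h1 : z + Complex.I ≠ 0 := by
      intro h
      have := congrArg Complex.im h
      simp at this
      linarith
    refine ⟨(z - Complex.I) / (z + Complex.I), ?_, ?_⟩
    · rw [mem_ball_zero_iff, norm_div, div_lt_one (norm_pos_iff.2 h1)]
      apply lt_of_pow_lt_pow_left₀ 2 (norm_nonneg _)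
      rw [← Complex.normSq_eq_norm_sq, ← Complex.normSq_eq_norm_sq, Complex.normSq_apply,
        Complex.normSq_apply]
      simp
      nlinarith
    · have h2 : 1 - (z - Complex.I) / (z + Complex.I) = 2 * Complex.I / (z + Complex.I) := by
        field_simp; ring
      rw [cayley, h2]
      field_simp [Complex.I_ne_zero]
      ring

theorem abs_det_restrictScalars_smul (c : ℂ) :
    |((c • (1 : ℂ →L[ℂ] ℂ)).restrictScalars ℝ).det| = ‖c‖ ^ 2 := by
  have h : (((c • (1 : ℂ →L[ℂ] ℂ)).restrictScalars ℝ : ℂ →L[ℝ] ℂ) : ℂ →ₗ[ℝ] ℂ)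
      = Algebra.lmul ℝ ℂ c := by
    ext
    simp
  rw [ContinuousLinearMap.det, h, ← Algebra.norm_apply, Algebra.norm_complex_apply,
    Complex.normSq_eq_norm_sq, abs_of_nonneg (by positivity)]

/-- Reproducing property, at `I`, of the weighted Bergman kernels of the upper half-plane. -/
theorem integral_halfPlane_reproducing (m : ℕ) {G : ℂ → ℂ}
    (hG : DifferentiableOn ℂ G {z : ℂ | 0 < z.im})
    (h_int : IntegrableOn (fun z => ((z.im ^ m : ℝ) : ℂ) *
      (((starRingEnd ℂ) z - Complex.I) ^ (m + 2))⁻¹ * G z) {z : ℂ | 0 < z.im}) :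
    ∫ z in {z : ℂ | 0 < z.im}, ((z.im ^ m : ℝ) : ℂ) *
      (((starRingEnd ℂ) z - Complex.I) ^ (m + 2))⁻¹ * G z
      = (Real.pi / (m + 1) : ℝ) * 4 * ((-2 * Complex.I) ^ (m + 2))⁻¹ * G Complex.I := by
  have hder : ∀ ζ ∈ Metric.ball (0 : ℂ) 1, HasFDerivWithinAt cayley
      (((2 * Complex.I / (1 - ζ) ^ 2) • (1 : ℂ →L[ℂ] ℂ)).restrictScalars ℝ)
      (Metric.ball (0 : ℂ) 1) ζ := fun ζ hζ => by
    have := (hasDerivAt_cayley (one_sub_ne_zero_of_mem_ball hζ)).hasFDerivAt.restrictScalars ℝ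
    refine (this.congr_fderiv ?_).hasFDerivWithinAt
    ext
    simp [mul_comm]
  have key : ∀ ζ ∈ Metric.ball (0 : ℂ) 1,
      |(((2 * Complex.I / (1 - ζ) ^ 2) • (1 : ℂ →L[ℂ] ℂ)).restrictScalars ℝ).det| •
      ((((cayley ζ).im ^ m : ℝ) : ℂ) *
      (((starRingEnd ℂ) (cayley ζ) - Complex.I) ^ (m + 2))⁻¹ * G (cayley ζ)) =
      (((1 - ‖ζ‖ ^ 2) ^ m : ℝ) : ℂ) * (4 * ((-2 * Complex.I) ^ (m + 2))⁻¹ *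
        ((1 - ζ) ^ (m + 2))⁻¹ * G (cayley ζ)) := by
    intro ζ hζ
    have h1 := one_sub_ne_zero_of_mem_ball hζ
    have h2 : (starRingEnd ℂ) (1 - ζ) ≠ 0 := (map_ne_zero _).2 h1
    rw [abs_det_restrictScalars_smul, cayley_im h1, conj_cayley_sub_I h1, Complex.real_smul]
    have h3 : ((‖1 - ζ‖ ^ 2 : ℝ) : ℂ) = (1 - ζ) * (starRingEnd ℂ) (1 - ζ) := by
      rw [Complex.mul_conj, Complex.normSq_eq_norm_sq]
    have h4 : ‖2 * Complex.I / (1 - ζ) ^ 2‖ ^ 2 = 4 / (‖1 - ζ‖ ^ 2) ^ 2 := by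
      simp; ring
    rw [h4, div_pow, div_pow, inv_div]
    simp only [Complex.ofReal_div, Complex.ofReal_pow _ m, Complex.ofReal_pow _ 2] at h3 ⊢
    rw [h3]
    generalize (starRingEnd ℂ) (1 - ζ) = t at *
    generalize 1 - ζ = s at *
    have h5 : (-2 * Complex.I) ^ (m + 2) ≠ 0 := by simp
    generalize (-2 * Complex.I) ^ (m + 2) = k at *
    push_cast
    field_simp
    ring
  rw [← image_cayley] at h_int ⊢
  rw [integrableOn_image_iff_integrableOn_abs_det_fderiv_smul volume measurableSet_ball hder
    injOn_cayley, integrableOn_congr_fun key measurableSet_ball] at h_int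
  rw [integral_image_eq_integral_abs_det_fderiv_smul volume measurableSet_ball hder
    injOn_cayley, setIntegral_congr_fun measurableSet_ball key, integral_disc_mul m _ h_int]
  · simp [cayley]; ring
  · have hc : DifferentiableOn ℂ cayley (Metric.ball 0 1) := fun ζ hζ =>
      (hasDerivAt_cayley (one_sub_ne_zero_of_mem_ball hζ)).differentiableAt.differentiableWithinAt
    have hGc : DifferentiableOn ℂ (fun ζ => G (cayley ζ)) (Metric.ball 0 1) :=
      hG.comp hc (by rw [← image_cayley]; exact Set.mapsTo_image _ _)
    refine DifferentiableOn.mul (DifferentiableOn.mul (by fun_prop) ?_) hGc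
    exact DifferentiableOn.inv (by fun_prop)
      fun ζ hζ => pow_ne_zero _ (one_sub_ne_zero_of_mem_ball hζ)

theorem mem_Siegel {m : ℕ} {z : SPoint m} : z ∈ Siegel m ↔ ∑ j, ‖z.1 j‖ ^ 2 < z.2.im := by
  rw [Siegel, Set.mem_ofPred_eq, srho, sub_pos]

theorem continuous_srho {m : ℕ} : Continuous (srho : SPoint m → ℝ) := by
  unfold srho
  fun_prop

theorem isOpen_Siegel (m : ℕ) : IsOpen (Siegel m) :=
  isOpen_lt continuous_const continuous_srho

theorem measurableSet_Siegel (m : ℕ) : MeasurableSet (Siegel m) :=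
  (isOpen_Siegel m).measurableSet

theorem im_pos_of_mem_Siegel {m : ℕ} {z : SPoint m} (hz : z ∈ Siegel m) : 0 < z.2.im :=
  lt_of_le_of_lt (by positivity) (mem_Siegel.1 hz)

theorem integral_Siegel_kernel_mul (m : ℕ) {G : SPoint m → ℂ} {k : ℂ → ℂ}
    (hG : DifferentiableOn ℂ G (Siegel m))
    (h_int : IntegrableOn (fun z : SPoint m => k z.2 * G z) (Siegel m)) :
    IntegrableOn (fun y : ℂ => (Real.pi ^ m * y.im ^ m / m.factorial : ℝ) * (k y * G (0, y)))
      {y : ℂ | 0 < y.im} ∧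
    ∫ z in Siegel m, k z.2 * G z = ∫ y in {y : ℂ | 0 < y.im},
      (Real.pi ^ m * y.im ^ m / m.factorial : ℝ) * (k y * G (0, y)) := by
  have hH : MeasurableSet {y : ℂ | 0 < y.im} :=
    (isOpen_lt continuous_const Complex.continuous_im).measurableSet
  rw [← integrable_indicator_iff hH, ← integral_indicator hH]
  rw [← integrable_indicator_iff (measurableSet_Siegel m)] at h_int
  rw [← integral_indicator (measurableSet_Siegel m)]
  rw [Measure.volume_eq_prod] at h_int ⊢
  have hslice : (fun y => ∫ x, (Siegel m).indicator (fun z : SPoint m => k z.2 * G z) (x, y))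
      =ᵐ[volume] {y : ℂ | 0 < y.im}.indicator fun y =>
      (Real.pi ^ m * y.im ^ m / m.factorial : ℝ) * (k y * G (0, y)) := by
    filter_upwards [h_int.prod_left_ae] with y hy
    have hind : (fun x => (Siegel m).indicator (fun z : SPoint m => k z.2 * G z) (x, y))
        = {x : Fin m → ℂ | ∑ j, ‖x j‖ ^ 2 < y.im}.indicator fun x => k y * G (x, y) := by
      ext x
      simp [Set.indicator, mem_Siegel]
    have hB : MeasurableSet {x : Fin m → ℂ | ∑ j, ‖x j‖ ^ 2 < y.im} :=
      (isOpen_lt (by fun_prop) (by fun_prop)).measurableSet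
    rw [hind] at hy ⊢
    rw [integrable_indicator_iff hB] at hy
    rw [integral_indicator hB]
    by_cases h : 0 < y.im
    · rw [integral_ball_eq_mul m h (DifferentiableOn.const_mul ?_ _) hy]
      · simp [Set.indicator, h]
      · exact hG.comp (by fun_prop) fun x hx => mem_Siegel.2 hx
    · have he : {x : Fin m → ℂ | ∑ j, ‖x j‖ ^ 2 < y.im} = ∅ := by
        ext x
        simp only [Set.mem_ofPred_eq, Set.mem_empty_iff_false, iff_false, not_lt]
        exact (not_lt.1 h).trans (by positivity)
      simp [he, Set.indicator, h]
  exact ⟨h_int.integral_prod_right.congr hslice, by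
    rw [integral_prod_symm _ h_int, integral_congr_ae hslice]⟩

theorem sK_base (m : ℕ) (z : SPoint m) :
    sK (m + 1) (((0 : Fin m → ℂ), Complex.I) : SPoint m) z =
      ((m + 1).factorial : ℂ) / (4 * (Real.pi : ℂ) ^ (m + 1)) *
        ((Complex.I / 2) ^ (m + 2))⁻¹ * (((starRingEnd ℂ) z.2 - Complex.I) ^ (m + 2))⁻¹ := by
  have h : (-((m + 1 : ℕ) + 1 : ℤ)) = -((m + 2 : ℕ) : ℤ) := by push_cast; ring
  rw [sK, srho2, h, zpow_neg, zpow_natCast]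
  simp [mul_pow]
  ring

/-- Reproducing property of the Bergman kernel at the base point `(0, I)`. -/
theorem integral_Siegel_reproducing_base (m : ℕ) {G : SPoint m → ℂ}
    (hG : DifferentiableOn ℂ G (Siegel m))
    (h_int : IntegrableOn (fun z : SPoint m =>
      sK (m + 1) (((0 : Fin m → ℂ), Complex.I) : SPoint m) z * G z) (Siegel m)) :
    ∫ z in Siegel m, sK (m + 1) (((0 : Fin m → ℂ), Complex.I) : SPoint m) z * G z
      = G (0, Complex.I) := by
  simp only [sK_base] at h_int ⊢
  set a : ℂ := ((m + 1).factorial : ℂ) / (4 * (Real.pi : ℂ) ^ (m + 1)) *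
    ((Complex.I / 2) ^ (m + 2))⁻¹ with ha
  obtain ⟨h1, h2⟩ := integral_Siegel_kernel_mul m
    (k := fun y => a * (((starRingEnd ℂ) y - Complex.I) ^ (m + 2))⁻¹) hG h_int
  have hpi : (Real.pi : ℂ) ≠ 0 := by exact_mod_cast Real.pi_ne_zero
  have hfac : ∀ k : ℕ, (k.factorial : ℂ) ≠ 0 := fun k => by exact_mod_cast k.factorial_ne_zero
  have hform : ∀ y : ℂ, (Real.pi ^ m * y.im ^ m / m.factorial : ℝ) *
      (a * (((starRingEnd ℂ) y - Complex.I) ^ (m + 2))⁻¹ * G (0, y)) =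
      ((Real.pi : ℂ) ^ m / m.factorial * a) * (((y.im ^ m : ℝ) : ℂ) *
      (((starRingEnd ℂ) y - Complex.I) ^ (m + 2))⁻¹ * G (0, y)) := fun y => by
    push_cast; ring
  have ha0 : (Real.pi : ℂ) ^ m / m.factorial * a ≠ 0 := by
    simp [ha, hpi, hfac]
  simp only [hform] at h1 h2
  rw [h2, integral_const_mul, integral_halfPlane_reproducing m (G := fun y => G (0, y))]
  · have h3 : ((-2 * Complex.I) ^ (m + 2))⁻¹ = (Complex.I / 2) ^ (m + 2) := by
      rw [← inv_pow]
      congr 1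
      rw [mul_inv, Complex.inv_I]; ring
    have h4 : (Complex.I / 2) ^ (m + 2) ≠ 0 := by simp
    have h5 : (m : ℂ) + 1 ≠ 0 := by exact_mod_cast m.succ_ne_zero
    rw [h3, ha, Nat.factorial_succ]
    have := hfac m
    push_cast
    generalize (Complex.I / 2) ^ (m + 2) = k at *
    field_simp
    ring
  · exact hG.comp (by fun_prop) fun y hy => mem_Siegel.2 (by simpa using hy)
  · exact (integrable_const_mul_iff (IsUnit.mk0 _ ha0) _).1 h1

/-- The affine automorphism of the Siegel half-space, a Heisenberg translation after a
dilation, that carries `(0, I)` to `w`. -/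
noncomputable def siegelAffine {m : ℕ} (w z : SPoint m) : SPoint m :=
  (w.1 + Real.sqrt (srho w) • z.1,
    srho w • z.2 + (w.2.re + 2 * Complex.I * ∑ j, (Real.sqrt (srho w) • z.1) j *
      (starRingEnd ℂ) (w.1 j) + Complex.I * (∑ j, ‖w.1 j‖ ^ 2 : ℝ)))

theorem siegelAffine_base {m : ℕ} (w : SPoint m) :
    siegelAffine w (0, Complex.I) = w := by
  ext
  · simp [siegelAffine]
  · apply Complex.ext <;> simp [siegelAffine, srho]

theorem srho2_siegelAffine {m : ℕ} {w : SPoint m} (z : SPoint m) :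
    srho2 w (siegelAffine w z) = srho w * srho2 ((0 : Fin m → ℂ), Complex.I) z := by
  have hw : w.2 = w.2.re + w.2.im * Complex.I := (Complex.re_add_im _).symm
  have h1 : ∀ j, (‖w.1 j‖ ^ 2 : ℂ) = w.1 j * (starRingEnd ℂ) (w.1 j) := fun j => by
    rw [Complex.mul_conj, Complex.normSq_eq_norm_sq]; push_cast; rfl
  simp only [siegelAffine, srho2]
  simp only [map_add, map_mul, map_sum, Complex.conj_I, Complex.conj_ofReal, Complex.conj_conj,
    Complex.real_smul, Pi.add_apply, Pi.smul_apply, mul_add, Finset.sum_add_distrib, map_ofNat,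
    Pi.zero_apply, zero_mul, Finset.sum_const_zero]
  have h2 : ∑ j, w.1 j * ((Real.sqrt (srho w) : ℂ) * (starRingEnd ℂ) (z.1 j)) =
    ∑ j, (Real.sqrt (srho w) : ℂ) * (starRingEnd ℂ) (z.1 j) * w.1 j :=
    Finset.sum_congr rfl fun j _ => by ring
  rw [h2]
  have h3 : ((srho w : ℝ) : ℂ) = w.2.im - ∑ j, w.1 j * (starRingEnd ℂ) (w.1 j) := by
    simp [srho, h1]
  have h4 : ((∑ j, ‖w.1 j‖ ^ 2 : ℝ) : ℂ) = ∑ j, w.1 j * (starRingEnd ℂ) (w.1 j) := by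
    simp [h1]
  rw [h4]
  nth_rewrite 2 [hw]
  generalize ∑ j, (Real.sqrt (srho w) : ℂ) * (starRingEnd ℂ) (z.1 j) * w.1 j = A
  linear_combination ((1 / 2) * Complex.I * Complex.I) * h3 +
    (-A - ∑ j, w.1 j * (starRingEnd ℂ) (w.1 j)) * Complex.I_sq

theorem srho_pos {m : ℕ} {w : SPoint m} (hw : w ∈ Siegel m) : 0 < srho w := by
  rwa [Siegel, Set.mem_ofPred_eq] at hw

theorem srho_siegelAffine {m : ℕ} {w : SPoint m} (hw : w ∈ Siegel m) (z : SPoint m) :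
    srho (siegelAffine w z) = srho w * srho z := by
  have hb : 0 ≤ srho w := (srho_pos hw).le
  have h1 : ∀ j, ‖w.1 j + Real.sqrt (srho w) • z.1 j‖ ^ 2 = ‖w.1 j‖ ^ 2 +
      2 * ((Real.sqrt (srho w) • z.1 j) * (starRingEnd ℂ) (w.1 j)).re
      + srho w * ‖z.1 j‖ ^ 2 := fun j => by
    nth_rewrite 3 [← Real.sq_sqrt hb]
    simp only [← Complex.normSq_eq_norm_sq, Complex.normSq_apply]
    simp
    ring
  have h2 : (siegelAffine w z).2.im = srho w * z.2.im +
      2 * (∑ j, (Real.sqrt (srho w) • z.1) j * (starRingEnd ℂ) (w.1 j)).re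
      + ∑ j, ‖w.1 j‖ ^ 2 := by
    simp only [siegelAffine]
    generalize ∑ j, (Real.sqrt (srho w) • z.1) j * (starRingEnd ℂ) (w.1 j) = A
    generalize ∑ j, ‖w.1 j‖ ^ 2 = B
    simp
    ring
  have h3 : ∑ j, ‖(siegelAffine w z).1 j‖ ^ 2 = ∑ j, ‖w.1 j‖ ^ 2 +
      2 * (∑ j, (Real.sqrt (srho w) • z.1) j * (starRingEnd ℂ) (w.1 j)).re
      + srho w * ∑ j, ‖z.1 j‖ ^ 2 := by
    simp only [siegelAffine, Pi.add_apply, Pi.smul_apply, h1, Finset.sum_add_distrib,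
      Finset.mul_sum, Complex.re_sum]
  rw [srho, h2, h3]
  conv_rhs => rw [srho.eq_def z]
  ring

theorem siegelAffine_preimage {m : ℕ} {w : SPoint m} (hw : w ∈ Siegel m) :
    siegelAffine w ⁻¹' Siegel m = Siegel m := by
  ext z
  simp only [Set.mem_preimage, Siegel, Set.mem_ofPred_eq, srho_siegelAffine hw]
  exact mul_pos_iff_of_pos_left (srho_pos hw)

theorem differentiable_siegelAffine {m : ℕ} (w : SPoint m) :
    Differentiable ℂ (siegelAffine w) := by
  unfold siegelAffine
  simp only [Pi.smul_apply]
  fun_prop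

theorem measurableEmbedding_siegelAffine {m : ℕ} {w : SPoint m} (hw : w ∈ Siegel m) :
    MeasurableEmbedding (siegelAffine w) := by
  refine (differentiable_siegelAffine w).continuous.measurableEmbedding fun a b h => ?_
  have hb : srho w ≠ 0 := (srho_pos hw).ne'
  have hs : Real.sqrt (srho w) ≠ 0 := (Real.sqrt_pos.2 (srho_pos hw)).ne'
  have h1 : a.1 = b.1 := smul_right_injective _ hs (add_left_cancel (congrArg Prod.fst h))
  have h2 := congrArg Prod.snd h
  simp only [siegelAffine, h1] at h2
  exact Prod.ext h1 (smul_right_injective _ hb (add_right_cancel h2))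

theorem map_siegelAffine_volume {m : ℕ} {w : SPoint m} (hw : w ∈ Siegel m) :
    Measure.map (siegelAffine w) volume = ENNReal.ofReal ((srho w ^ (m + 2))⁻¹) • volume := by
  have hb : 0 < srho w := srho_pos hw
  have hs : 0 < Real.sqrt (srho w) := Real.sqrt_pos.2 hb
  set c : (Fin m → ℂ) → ℂ := fun x => w.2.re + 2 * Complex.I * ∑ j, x j *
      (starRingEnd ℂ) (w.1 j) + Complex.I * (∑ j, ‖w.1 j‖ ^ 2 : ℝ) with hc
  have hshear : MeasurePreserving (fun p : SPoint m => (w.1 + p.1, p.2 + c p.1))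
      (volume.prod volume) (volume.prod volume) := by
    refine (measurePreserving_add_left volume w.1).skew_product (g := fun x y => y + c x) ?_
      (ae_of_all _ fun x => (measurePreserving_add_right volume (c x)).map_eq)
    apply Continuous.measurable
    unfold Function.uncurry
    fun_prop
  have hcomp : siegelAffine w = (fun p : SPoint m => (w.1 + p.1, p.2 + c p.1)) ∘
      Prod.map (fun x => Real.sqrt (srho w) • x) (fun y => srho w • y) := rfl
  have hd : Measure.map (Prod.map (fun x : Fin m → ℂ => Real.sqrt (srho w) • x)
      (fun y : ℂ => srho w • y)) (volume.prod volume)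
      = ENNReal.ofReal ((srho w ^ (m + 2))⁻¹) • (volume.prod volume) := by
    rw [← Measure.map_prod_map _ _ (by fun_prop) (by fun_prop),
      Measure.map_addHaar_smul _ hs.ne', Measure.map_addHaar_smul _ hb.ne',
      Measure.prod_smul_left, Measure.prod_smul_right, smul_smul, ← ENNReal.ofReal_mul (by positivity)]
    congr 2
    rw [abs_of_pos (by positivity), abs_of_pos (by positivity), ← mul_inv]
    congr 1
    rw [Module.finrank_pi_fintype]
    simp only [Complex.finrank_real_complex, Finset.sum_const, Finset.card_univ, Fintype.card_fin,
      smul_eq_mul]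
    rw [mul_comm m 2, pow_mul, Real.sq_sqrt hb.le, ← pow_add]
  rw [hcomp, Measure.volume_eq_prod, ← Measure.map_map hshear.measurable (by fun_prop), hd,
    Measure.map_smul, hshear.map_eq]

theorem map_siegelAffine_restrict {m : ℕ} {w : SPoint m} (hw : w ∈ Siegel m) :
    Measure.map (siegelAffine w) (volume.restrict (Siegel m))
      = ENNReal.ofReal ((srho w ^ (m + 2))⁻¹) • volume.restrict (Siegel m) := by
  rw [← Measure.restrict_smul, ← map_siegelAffine_volume hw,
    Measure.restrict_map (measurableEmbedding_siegelAffine hw).measurable (measurableSet_Siegel m),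
    siegelAffine_preimage hw]

theorem lintegral_siegelAffine {m : ℕ} {w : SPoint m} (hw : w ∈ Siegel m)
    (h : SPoint m → ENNReal) :
    ∫⁻ z in Siegel m, h z = ENNReal.ofReal (srho w ^ (m + 2)) *
      ∫⁻ z in Siegel m, h (siegelAffine w z) := by
  have hb : 0 < srho w := srho_pos hw
  rw [← (measurableEmbedding_siegelAffine hw).lintegral_map, map_siegelAffine_restrict hw,
    lintegral_smul_measure, smul_eq_mul, ← mul_assoc, ← ENNReal.ofReal_mul (by positivity),
    mul_inv_cancel₀ (by positivity), ENNReal.ofReal_one, one_mul]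

theorem integrableOn_comp_siegelAffine {m : ℕ} {w : SPoint m} (hw : w ∈ Siegel m)
    {h : SPoint m → ℂ} (hh : IntegrableOn h (Siegel m)) :
    IntegrableOn (fun z => h (siegelAffine w z)) (Siegel m) := by
  have := hh.smul_measure (c := ENNReal.ofReal ((srho w ^ (m + 2))⁻¹)) ENNReal.ofReal_ne_top
  rw [← map_siegelAffine_restrict hw, (measurableEmbedding_siegelAffine hw).integrable_map_iff]
    at this
  exact this

theorem integral_siegelAffine {m : ℕ} {w : SPoint m} (hw : w ∈ Siegel m) (h : SPoint m → ℂ) :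
    ∫ z in Siegel m, h z = (srho w ^ (m + 2) : ℝ) * ∫ z in Siegel m, h (siegelAffine w z) := by
  have hb : 0 < srho w := srho_pos hw
  rw [← (measurableEmbedding_siegelAffine hw).integral_map, map_siegelAffine_restrict hw,
    integral_smul_measure, ENNReal.toReal_ofReal (by positivity), Complex.real_smul, ← mul_assoc,
    ← Complex.ofReal_mul, mul_inv_cancel₀ (by positivity), Complex.ofReal_one, one_mul]

theorem sK_siegelAffine {m : ℕ} (w z : SPoint m) :
    sK (m + 1) w (siegelAffine w z) = ((srho w ^ (m + 2) : ℝ) : ℂ)⁻¹ *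
      sK (m + 1) (((0 : Fin m → ℂ), Complex.I) : SPoint m) z := by
  have h : (-((m + 1 : ℕ) + 1 : ℤ)) = -((m + 2 : ℕ) : ℤ) := by push_cast; ring
  simp only [sK]
  rw [srho2_siegelAffine, h, zpow_neg, zpow_natCast, zpow_neg, zpow_natCast]
  push_cast
  rw [mul_pow, mul_inv]
  ring

/-- Reproducing property of the Bergman kernel of the Siegel half-space. -/
theorem integral_Siegel_reproducing {m : ℕ} {w : SPoint m} (hw : w ∈ Siegel m) {G : SPoint m → ℂ}
    (hG : DifferentiableOn ℂ G (Siegel m))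
    (h_int : IntegrableOn (fun z : SPoint m => sK (m + 1) w z * G z) (Siegel m)) :
    ∫ z in Siegel m, sK (m + 1) w z * G z = G w := by
  have hb : ((srho w ^ (m + 2) : ℝ) : ℂ) ≠ 0 := by
    exact_mod_cast (pow_pos (srho_pos hw) _).ne'
  have h_int' := integrableOn_comp_siegelAffine hw h_int
  rw [integral_siegelAffine hw]
  simp only [sK_siegelAffine, mul_assoc] at h_int' ⊢
  rw [IntegrableOn, integrable_const_mul_iff (IsUnit.mk0 _ (inv_ne_zero hb))] at h_int'
  rw [integral_const_mul, ← mul_assoc, mul_inv_cancel₀ hb, one_mul]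
  rw [integral_Siegel_reproducing_base m (G := fun z => G (siegelAffine w z)) ?_ h_int',
    siegelAffine_base]
  refine hG.comp (differentiable_siegelAffine w).differentiableOn fun z hz => ?_
  rwa [← siegelAffine_preimage hw] at hz

theorem sq_norm_le_sum_sq_norm {m : ℕ} (x : Fin m → ℂ) : ‖x‖ ^ 2 ≤ ∑ j, ‖x j‖ ^ 2 := by
  rw [← Real.le_sqrt (norm_nonneg _) (by positivity)]
  refine (pi_norm_le_iff_of_nonneg (Real.sqrt_nonneg _)).2 fun j => ?_
  refine Real.le_sqrt_of_sq_le ?_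
  exact Finset.single_le_sum (f := fun j => ‖x j‖ ^ 2) (fun _ _ => by positivity)
    (Finset.mem_univ j)

theorem integrableOn_rpow_mul_one_add_rpow {t s : ℝ} (ht : -1 < t) (hs : t + 1 < s) :
    IntegrableOn (fun y : ℝ => y ^ t * (1 + y) ^ (-s)) (Set.Ioi 0) := by
  have hmeas : Measurable fun y : ℝ => y ^ t * (1 + y) ^ (-s) := by fun_prop
  rw [← Set.Ioc_union_Ioi_eq_Ioi zero_le_one]
  refine IntegrableOn.union ?_ ?_
  · have h : IntegrableOn (fun y : ℝ => y ^ t) (Set.Ioc 0 1) :=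
      (intervalIntegrable_iff_integrableOn_Ioc_of_le zero_le_one).1
        (intervalIntegral.intervalIntegrable_rpow' ht)
    refine Integrable.mono' h hmeas.aestronglyMeasurable
      ((ae_restrict_iff' measurableSet_Ioc).2 (ae_of_all _ fun y hy => ?_))
    have h1 : 0 < y := hy.1
    have h2 : (1 + y) ^ (-s) ≤ 1 := Real.rpow_le_one_of_one_le_of_nonpos (by linarith) (by linarith)
    rw [Real.norm_of_nonneg (by positivity)]
    exact mul_le_of_le_one_right (by positivity) h2
  · refine Integrable.mono' (integrableOn_Ioi_rpow_of_lt (a := t - s) (by linarith) one_pos)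
      hmeas.aestronglyMeasurable ((ae_restrict_iff' measurableSet_Ioi).2 (ae_of_all _ fun y hy => ?_))
    have h1 : 0 < y := one_pos.trans hy
    rw [Real.norm_of_nonneg (by positivity), sub_eq_add_neg, Real.rpow_add h1]
    gcongr y ^ t * ?_
    exact Real.rpow_le_rpow_of_nonpos h1 (by linarith) (by linarith)

theorem lintegral_complex_re_im {b d : ℝ → ENNReal} (hb : Measurable b) (hd : Measurable d) :
    ∫⁻ y : ℂ, b y.re * d y.im = (∫⁻ u, b u) * ∫⁻ v, d v := by
  rw [← lintegral_prod_mul hb.aemeasurable hd.aemeasurable, ← Measure.volume_eq_prod,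
    ← Complex.volume_preserving_equiv_real_prod.lintegral_comp (by fun_prop)]
  rfl

theorem lintegral_Siegel_rpow_lt_top (m : ℕ) {t s : ℝ} (ht : -1 < t) (hs : m + 2 + t < s) :
    ∫⁻ z in Siegel m, ENNReal.ofReal (srho z ^ t * ‖z.2 + Complex.I‖ ^ (-s)) < ⊤ := by
  obtain ⟨ε, hε, hsε⟩ : ∃ ε : ℝ, 0 < ε ∧ s = (m + ε) + (t + 1 + ε) + (1 + ε) :=
    ⟨(s - (m + 2 + t)) / 3, by linarith, by ring⟩
  set q : (Fin m → ℂ) → ℝ := fun x => ∑ j, ‖x j‖ ^ 2 with hq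
  have hq0 : ∀ x, 0 ≤ q x := fun x => by positivity
  have hΦ : MeasurePreserving (fun p : SPoint m => (p.1, p.2 + Complex.I * (q p.1 : ℂ)))
      (volume.prod volume) (volume.prod volume) := by
    refine (MeasurePreserving.id volume).skew_product
      (g := fun x y => y + Complex.I * (q x : ℂ)) ?_
      (ae_of_all _ fun x => (measurePreserving_add_right volume _).map_eq)
    apply Continuous.measurable
    unfold Function.uncurry
    fun_prop
  have hmeas : Measurable fun z : SPoint m =>
      ENNReal.ofReal (srho z ^ t * ‖z.2 + Complex.I‖ ^ (-s)) := by
    have := (continuous_srho (m := m)).measurable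
    fun_prop
  have hpre : (fun p : SPoint m => (p.1, p.2 + Complex.I * (q p.1 : ℂ))) ⁻¹' Siegel m
      = {p | 0 < p.2.im} := by
    ext p
    simp [mem_Siegel, hq, -Complex.ofReal_pow, -Complex.ofReal_sum]
  have hH : MeasurableSet {p : SPoint m | 0 < p.2.im} :=
    (isOpen_lt (by fun_prop) (by fun_prop)).measurableSet
  set a : (Fin m → ℂ) → ENNReal := fun x =>
    ENNReal.ofReal ((1 + ‖x‖ ^ 2) ^ (-(2 * (m + ε)) / 2)) with ha
  set b : ℝ → ENNReal := fun u =>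
    ENNReal.ofReal (2 ^ (1 + ε) * (1 + ‖u‖) ^ (-(1 + ε))) with hb
  set d : ℝ → ENNReal := (Set.Ioi 0).indicator fun v =>
    ENNReal.ofReal (v ^ t * (1 + v) ^ (-(t + 1 + ε))) with hd
  have hdm : Measurable d := Measurable.indicator (by fun_prop) measurableSet_Ioi
  have hbound : ∀ p ∈ {p : SPoint m | 0 < p.2.im},
      ENNReal.ofReal (srho (p.1, p.2 + Complex.I * (q p.1 : ℂ)) ^ t *
        ‖p.2 + Complex.I * (q p.1 : ℂ) + Complex.I‖ ^ (-s)) ≤ a p.1 * (b p.2.re * d p.2.im) := by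
    rintro ⟨x, y⟩ hy
    simp only [Set.mem_ofPred_eq] at hy
    have h1 : srho (x, y + Complex.I * (q x : ℂ)) = y.im := by
      simp only [srho]
      simp [hq, -Complex.ofReal_pow, -Complex.ofReal_sum]
    simp only [ha, hb, hd, h1]
    rw [Set.indicator_of_mem (show y.im ∈ Set.Ioi 0 from hy),
      ← ENNReal.ofReal_mul (by positivity), ← ENNReal.ofReal_mul (by positivity)]
    apply ENNReal.ofReal_le_ofReal
    set N := ‖y + Complex.I * (q x : ℂ) + Complex.I‖ with hN
    have hqx := sq_norm_le_sum_sq_norm x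
    have him : y.im + q x + 1 ≤ N := by
      have := Complex.abs_im_le_norm (y + Complex.I * (q x : ℂ) + Complex.I)
      have h3 : (y + Complex.I * (q x : ℂ) + Complex.I).im = y.im + q x + 1 := by simp
      rw [h3] at this
      exact (le_abs_self _).trans this
    have hre : |y.re| ≤ N := by
      have := Complex.abs_re_le_norm (y + Complex.I * (q x : ℂ) + Complex.I)
      have h3 : (y + Complex.I * (q x : ℂ) + Complex.I).re = y.re := by simp
      rwa [h3] at this
    have hN0 : 0 < N := by linarith [hq0 x]
    have e1 : N ^ (-(m + ε)) ≤ (1 + ‖x‖ ^ 2) ^ (-(2 * (m + ε)) / 2) := by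
      rw [show -(2 * (m + ε)) / 2 = -(m + ε) by ring]
      exact Real.rpow_le_rpow_of_nonpos (by positivity) (by linarith [hq0 x]) (by
        have : (0 : ℝ) ≤ m := by positivity
        linarith)
    have e2 : N ^ (-(t + 1 + ε)) ≤ (1 + y.im) ^ (-(t + 1 + ε)) :=
      Real.rpow_le_rpow_of_nonpos (by positivity) (by linarith [hq0 x]) (by linarith)
    have e3 : N ^ (-(1 + ε)) ≤ 2 ^ (1 + ε) * (1 + ‖y.re‖) ^ (-(1 + ε)) := by
      have : 2 ^ (1 + ε) * (1 + ‖y.re‖) ^ (-(1 + ε)) = ((1 + ‖y.re‖) / 2) ^ (-(1 + ε)) := by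
        rw [Real.div_rpow (by positivity) (by norm_num), Real.rpow_neg (by norm_num : (0:ℝ) ≤ 2),
          div_inv_eq_mul, mul_comm]
      rw [this]
      refine Real.rpow_le_rpow_of_nonpos (by positivity) ?_ (by linarith)
      rw [Real.norm_eq_abs]
      linarith [hq0 x]
    have e4 : N ^ (-s) = N ^ (-(m + ε)) * N ^ (-(t + 1 + ε)) * N ^ (-(1 + ε)) := by
      rw [← Real.rpow_add hN0, ← Real.rpow_add hN0, hsε]
      congr 1; ring
    rw [e4]
    calc y.im ^ t * (N ^ (-(m + ε)) * N ^ (-(t + 1 + ε)) * N ^ (-(1 + ε)))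
        ≤ y.im ^ t * ((1 + ‖x‖ ^ 2) ^ (-(2 * (m + ε)) / 2) * (1 + y.im) ^ (-(t + 1 + ε)) *
          (2 ^ (1 + ε) * (1 + ‖y.re‖) ^ (-(1 + ε)))) := by gcongr
      _ = _ := by ring
  have hA : ∫⁻ x, a x < ⊤ := Integrable.lintegral_lt_top <| by
    refine integrable_rpow_neg_one_add_norm_sq ?_
    rw [Module.finrank_pi_fintype]
    simp only [Complex.finrank_real_complex, Finset.sum_const, Finset.card_univ, Fintype.card_fin,
      smul_eq_mul]
    push_cast
    linarith
  have hB : ∫⁻ u, b u < ⊤ := Integrable.lintegral_lt_top <|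
    (integrable_one_add_norm (by simpa using hε)).const_mul _
  have hD : ∫⁻ v, d v < ⊤ := by
    rw [hd, lintegral_indicator measurableSet_Ioi]
    exact (integrableOn_rpow_mul_one_add_rpow ht (by linarith)).lintegral_lt_top
  rw [Measure.volume_eq_prod, ← hΦ.setLIntegral_comp_preimage (measurableSet_Siegel m) hmeas, hpre]
  calc _ ≤ ∫⁻ p : SPoint m in {p | 0 < p.2.im}, a p.1 * (b p.2.re * d p.2.im)
        ∂(volume.prod volume) := setLIntegral_mono' hH hbound
    _ ≤ ∫⁻ p : SPoint m, a p.1 * (b p.2.re * d p.2.im) ∂(volume.prod volume) :=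
        setLIntegral_le_lintegral _ _
    _ = (∫⁻ x, a x) * ((∫⁻ u, b u) * ∫⁻ v, d v) := by
        rw [← lintegral_complex_re_im (by fun_prop) hdm]
        exact lintegral_prod_mul (f := a) (g := fun y : ℂ => b y.re * d y.im) (by fun_prop)
          (by fun_prop)
    _ < ⊤ := ENNReal.mul_lt_top hA (ENNReal.mul_lt_top hB hD)

theorem srho2_conj {m : ℕ} (z w : SPoint m) : (starRingEnd ℂ) (srho2 z w) = srho2 w z := by
  simp only [srho2, map_sub, map_mul, map_div₀, Complex.conj_I, map_sum, Complex.conj_conj,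
    map_ofNat]
  have : ∑ j, (starRingEnd ℂ) (z.1 j) * w.1 j = ∑ j, w.1 j * (starRingEnd ℂ) (z.1 j) :=
    Finset.sum_congr rfl fun j _ => mul_comm _ _
  rw [this]
  ring

theorem sK_conj {m : ℕ} (z w : SPoint m) :
    (starRingEnd ℂ) (sK (m + 1) z w) = sK (m + 1) w z := by
  simp only [sK]
  rw [map_mul, map_zpow₀, srho2_conj, map_div₀, map_mul, map_pow, Complex.conj_ofReal,
    map_natCast, map_ofNat]

theorem enorm_sK_comm {m : ℕ} (z w : SPoint m) : ‖sK (m + 1) z w‖ₑ = ‖sK (m + 1) w z‖ₑ := by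
  rw [← sK_conj z w, ← ofReal_norm, ← ofReal_norm, RCLike.norm_conj]

theorem srho2_ne_zero {m : ℕ} {z w : SPoint m} (hz : z ∈ Siegel m) (hw : w ∈ Siegel m) :
    srho2 z w ≠ 0 := by
  intro h
  have h1 := congrArg Complex.re h
  have h2 : (srho2 z w).re = (z.2.im + w.2.im) / 2 -
      ∑ j, (z.1 j * (starRingEnd ℂ) (w.1 j)).re := by
    rw [srho2, Complex.sub_re, Complex.re_sum]
    congr 1
    simp
    ring
  have h3 : ∑ j, (z.1 j * (starRingEnd ℂ) (w.1 j)).re ≤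
      ∑ j, (‖z.1 j‖ ^ 2 + ‖w.1 j‖ ^ 2) / 2 := Finset.sum_le_sum fun j _ => by
    have := Complex.re_le_norm (z.1 j * (starRingEnd ℂ) (w.1 j))
    rw [norm_mul, RCLike.norm_conj] at this
    nlinarith [sq_nonneg (‖z.1 j‖ - ‖w.1 j‖)]
  rw [← Finset.sum_div, Finset.sum_add_distrib] at h3
  have h4 := mem_Siegel.1 hz
  have h5 := mem_Siegel.1 hw
  rw [h2] at h1
  simp only [Complex.zero_re] at h1
  linarith

theorem measurable_sK (m : ℕ) :
    Measurable fun q : SPoint m × SPoint m => sK (m + 1) q.1 q.2 := by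
  have h : (-((m + 1 : ℕ) + 1 : ℤ)) = -((m + 2 : ℕ) : ℤ) := by push_cast; ring
  have hc : Measurable fun q : SPoint m × SPoint m => srho2 q.1 q.2 := by
    apply Continuous.measurable
    unfold srho2
    fun_prop
  simp only [sK]
  rw [h]
  simp only [zpow_neg, zpow_natCast]
  fun_prop

theorem differentiableOn_sK {m : ℕ} {z : SPoint m} (hz : z ∈ Siegel m) :
    DifferentiableOn ℂ (fun w : SPoint m => sK (m + 1) w z) (Siegel m) := by
  have h : (-((m + 1 : ℕ) + 1 : ℤ)) = -((m + 2 : ℕ) : ℤ) := by push_cast; ring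
  have hc : Differentiable ℂ fun w : SPoint m => srho2 w z := by
    unfold srho2
    fun_prop
  simp only [sK]
  rw [h]
  simp only [zpow_neg, zpow_natCast]
  refine DifferentiableOn.const_mul (DifferentiableOn.inv (by fun_prop) fun w hw => ?_) _
  exact pow_ne_zero _ (srho2_ne_zero hw hz)

theorem one_le_norm_add_I {m : ℕ} {z : SPoint m} (hz : z ∈ Siegel m) :
    1 ≤ ‖z.2 + Complex.I‖ := by
  have h1 := Complex.abs_im_le_norm (z.2 + Complex.I)
  have h2 := im_pos_of_mem_Siegel hz
  simp only [Complex.add_im, Complex.I_im] at h1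
  linarith [le_abs_self (z.2.im + 1)]

theorem SAlpha.lintegral_enorm_sq_lt_top {m : ℕ} {γ : ℝ} (hγ : (m : ℝ) + 1 < γ)
    {g : SPoint m → ℂ} (hg : SAlpha (m + 1) γ g) : ∫⁻ z in Siegel m, ‖g z‖ₑ ^ 2 < ⊤ := by
  obtain ⟨-, M, hM⟩ := hg
  have hs : (m : ℝ) + 2 + 0 < 2 * γ := by
    have : (0 : ℝ) ≤ m := by positivity
    linarith
  have hb : ∀ z ∈ Siegel m, ‖g z‖ₑ ^ 2 ≤ ENNReal.ofReal (M ^ 2) *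
      ENNReal.ofReal (srho z ^ (0 : ℝ) * ‖z.2 + Complex.I‖ ^ (-(2 * γ))) := by
    intro z hz
    have hN : 0 < ‖z.2 + Complex.I‖ := one_pos.trans_le (one_le_norm_add_I hz)
    rw [← ofReal_norm, ← ENNReal.ofReal_pow (norm_nonneg _), ← ENNReal.ofReal_mul (by positivity)]
    apply ENNReal.ofReal_le_ofReal
    have h1 : ‖g z‖ ≤ M * ‖z.2 + Complex.I‖ ^ (-γ) := by
      rw [Real.rpow_neg hN.le, ← div_eq_mul_inv, le_div_iff₀ (by positivity), mul_comm]
      exact hM z hz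
    calc ‖g z‖ ^ 2 ≤ (M * ‖z.2 + Complex.I‖ ^ (-γ)) ^ 2 := by gcongr
      _ = M ^ 2 * (srho z ^ (0 : ℝ) * ‖z.2 + Complex.I‖ ^ (-(2 * γ))) := by
        rw [mul_pow, Real.rpow_zero, one_mul, ← Real.rpow_natCast (_ ^ (-γ)), ← Real.rpow_mul hN.le]
        congr 2
        push_cast
        ring
  refine (setLIntegral_mono' (measurableSet_Siegel m) hb).trans_lt ?_
  rw [lintegral_const_mul' _ _ ENNReal.ofReal_ne_top]
  exact ENNReal.mul_lt_top ENNReal.ofReal_lt_top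
    (lintegral_Siegel_rpow_lt_top m (by norm_num) hs)

/-- The Bergman kernel, tested against `ρ ^ (-1/2)`. -/
theorem exists_lintegral_sK_le (m : ℕ) : ∃ C : ENNReal, C ≠ ⊤ ∧ ∀ w ∈ Siegel m,
    ∫⁻ z in Siegel m, ENNReal.ofReal (srho z ^ (-(1 / 2) : ℝ)) * ‖sK (m + 1) w z‖ₑ ≤
      C * ENNReal.ofReal (srho w ^ (-(1 / 2) : ℝ)) := by
  set o : SPoint m := ((0 : Fin m → ℂ), Complex.I) with ho
  refine ⟨∫⁻ z in Siegel m, ENNReal.ofReal (srho z ^ (-(1 / 2) : ℝ)) * ‖sK (m + 1) o z‖ₑ,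
    ?_, fun w hw => ?_⟩
  · refine ne_of_lt ?_
    set c : ℂ := ((m + 1).factorial : ℂ) / (4 * (Real.pi : ℂ) ^ (m + 1)) *
        ((Complex.I / 2) ^ (m + 2))⁻¹ with hc
    have h : ∀ z ∈ Siegel m, ENNReal.ofReal (srho z ^ (-(1 / 2) : ℝ)) * ‖sK (m + 1) o z‖ₑ
        = ‖c‖ₑ * ENNReal.ofReal (srho z ^ (-(1 / 2) : ℝ) *
          ‖z.2 + Complex.I‖ ^ (-(m + 2 : ℝ))) := fun z hz => by
      have hρ := srho_pos hz
      have h1 : ‖(starRingEnd ℂ) z.2 - Complex.I‖ = ‖z.2 + Complex.I‖ := by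
        rw [← RCLike.norm_conj (z.2 + Complex.I), map_add, Complex.conj_I, sub_eq_add_neg]
      have h2 : ‖(((starRingEnd ℂ) z.2 - Complex.I) ^ (m + 2))⁻¹‖
          = ‖z.2 + Complex.I‖ ^ (-(m + 2 : ℝ)) := by
        rw [norm_inv, norm_pow, h1, Real.rpow_neg (norm_nonneg _), ← Real.rpow_natCast]
        push_cast
        rfl
      rw [ho, sK_base, enorm_mul, ← ofReal_norm (_⁻¹ : ℂ), h2,
        ENNReal.ofReal_mul (by positivity)]
      ring
    rw [setLIntegral_congr_fun (measurableSet_Siegel m) h, lintegral_const_mul' _ _ enorm_ne_top]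
    exact ENNReal.mul_lt_top enorm_lt_top
      (lintegral_Siegel_rpow_lt_top m (by norm_num) (by linarith))
  · have hb := srho_pos hw
    rw [lintegral_siegelAffine hw]
    have h : ∀ z ∈ Siegel m, ENNReal.ofReal (srho (siegelAffine w z) ^ (-(1 / 2) : ℝ)) *
        ‖sK (m + 1) w (siegelAffine w z)‖ₑ =
        ENNReal.ofReal (srho w ^ (-(1 / 2) : ℝ) * (srho w ^ (m + 2))⁻¹) *
        (ENNReal.ofReal (srho z ^ (-(1 / 2) : ℝ)) * ‖sK (m + 1) o z‖ₑ) := fun z hz => by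
      have hz' := srho_pos hz
      rw [srho_siegelAffine hw, sK_siegelAffine, enorm_mul,
        Real.mul_rpow hb.le hz'.le, ENNReal.ofReal_mul (by positivity),
        ENNReal.ofReal_mul (by positivity), ← ofReal_norm ((_ : ℂ)⁻¹), norm_inv, Complex.norm_real,
        Real.norm_of_nonneg (by positivity)]
      ring
    rw [setLIntegral_congr_fun (measurableSet_Siegel m) h,
      lintegral_const_mul' _ _ ENNReal.ofReal_ne_top, ← mul_assoc,
      ← ENNReal.ofReal_mul (by positivity), mul_comm]
    refine le_of_eq ?_
    congr 2
    field_simp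

theorem enorm_mul_enorm_le {x y : ℂ} {c d : ℝ} (hc : 0 < c) (hd : 0 < d) :
    ‖x‖ₑ * ‖y‖ₑ ≤ ‖x‖ₑ ^ 2 * (ENNReal.ofReal (c ^ (1 / 2 : ℝ)) * ENNReal.ofReal (d ^ (-(1 / 2) : ℝ)))
      + ‖y‖ₑ ^ 2 * (ENNReal.ofReal (d ^ (1 / 2 : ℝ)) * ENNReal.ofReal (c ^ (-(1 / 2) : ℝ))) := by
  have h1 : 0 < c ^ (1 / 2 : ℝ) := by positivity
  have h2 : 0 < d ^ (1 / 2 : ℝ) := by positivity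
  rw [← ofReal_norm, ← ofReal_norm, Real.rpow_neg hc.le, Real.rpow_neg hd.le]
  generalize c ^ (1 / 2 : ℝ) = s at *
  generalize d ^ (1 / 2 : ℝ) = t at *
  have h3 := norm_nonneg x
  have h4 := norm_nonneg y
  generalize ‖x‖ = a at *
  generalize ‖y‖ = b at *
  rw [← ENNReal.ofReal_mul h1.le, ← ENNReal.ofReal_mul h2.le, ← ENNReal.ofReal_pow h3,
    ← ENNReal.ofReal_pow h4, ← ENNReal.ofReal_mul h3, ← ENNReal.ofReal_mul (by positivity),
    ← ENNReal.ofReal_mul (by positivity), ← ENNReal.ofReal_add (by positivity) (by positivity)]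
  apply ENNReal.ofReal_le_ofReal
  have h5 : a ^ 2 * (s * t⁻¹) + b ^ 2 * (t * s⁻¹) - 2 * (a * b)
      = (a * s - b * t) ^ 2 * (s⁻¹ * t⁻¹) := by
    field_simp
    ring
  have : 0 ≤ (a * s - b * t) ^ 2 * (s⁻¹ * t⁻¹) := by positivity
  have : 0 ≤ a * b := by positivity
  linarith

theorem exists_lintegral_mul_sK_le (m : ℕ) : ∃ C : ENNReal, C ≠ ⊤ ∧
    ∀ (h : SPoint m → ℂ), ∀ z ∈ Siegel m,
      ∫⁻ w in Siegel m, ‖h z‖ₑ ^ 2 * (ENNReal.ofReal (srho z ^ (1 / 2 : ℝ)) *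
        ENNReal.ofReal (srho w ^ (-(1 / 2) : ℝ))) * ‖sK (m + 1) z w‖ₑ ≤ C * ‖h z‖ₑ ^ 2 := by
  obtain ⟨C, hC, hCK⟩ := exists_lintegral_sK_le m
  refine ⟨C, hC, fun h z hz => ?_⟩
  have hcancel : ENNReal.ofReal (srho z ^ (1 / 2 : ℝ)) *
      ENNReal.ofReal (srho z ^ (-(1 / 2) : ℝ)) = 1 := by
    have := srho_pos hz
    rw [← ENNReal.ofReal_mul (by positivity), ← Real.rpow_add this]
    simp
  simp only [mul_assoc]
  rw [lintegral_const_mul' _ _ (by finiteness), lintegral_const_mul' _ _ ENNReal.ofReal_ne_top]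
  calc _ ≤ ‖h z‖ₑ ^ 2 * (ENNReal.ofReal (srho z ^ (1 / 2 : ℝ)) *
        (C * ENNReal.ofReal (srho z ^ (-(1 / 2) : ℝ)))) := by gcongr; exact hCK z hz
    _ = C * ‖h z‖ₑ ^ 2 * (ENNReal.ofReal (srho z ^ (1 / 2 : ℝ)) *
        ENNReal.ofReal (srho z ^ (-(1 / 2) : ℝ))) := by ring
    _ = _ := by rw [hcancel, mul_one]

theorem measurable_sK_right {m : ℕ} (z : SPoint m) :
    Measurable fun w : SPoint m => sK (m + 1) z w := by
  have h : Measurable fun w : SPoint m => (z, w) := by fun_prop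
  have h2 := Measurable.comp (g := fun q : SPoint m × SPoint m => sK (m + 1) q.1 q.2)
    (measurable_sK m) h
  simpa only [Function.comp_def] using h2

theorem lintegral_mul_sK_le_add {m : ℕ} (f g : SPoint m → ℂ) {z : SPoint m} (hz : z ∈ Siegel m) :
    ∫⁻ w in Siegel m, ‖g z‖ₑ * ‖f w‖ₑ * ‖sK (m + 1) z w‖ₑ ≤
      (∫⁻ w in Siegel m, ‖g z‖ₑ ^ 2 * (ENNReal.ofReal (srho z ^ (1 / 2 : ℝ)) *
        ENNReal.ofReal (srho w ^ (-(1 / 2) : ℝ))) * ‖sK (m + 1) z w‖ₑ) +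
      ∫⁻ w in Siegel m, ‖f w‖ₑ ^ 2 * (ENNReal.ofReal (srho w ^ (1 / 2 : ℝ)) *
        ENNReal.ofReal (srho z ^ (-(1 / 2) : ℝ))) * ‖sK (m + 1) w z‖ₑ := by
  have hρ := (continuous_srho (m := m)).measurable
  have hKz := (measurable_sK_right z).enorm
  have hm : Measurable fun w : SPoint m => ‖g z‖ₑ ^ 2 * (ENNReal.ofReal (srho z ^ (1 / 2 : ℝ)) *
      ENNReal.ofReal (srho w ^ (-(1 / 2) : ℝ))) * ‖sK (m + 1) z w‖ₑ :=
    Measurable.mul (by fun_prop) hKz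
  rw [← lintegral_add_left hm]
  refine setLIntegral_mono' (measurableSet_Siegel m) fun w hw => ?_
  rw [enorm_sK_comm w z, ← add_mul]
  exact mul_le_mul_left (enorm_mul_enorm_le (srho_pos hz) (srho_pos hw)) _

theorem lintegral_lintegral_sK_lt_top {m : ℕ} {f g : SPoint m → ℂ}
    (hfm : AEMeasurable f (volume.restrict (Siegel m)))
    (hgm : AEMeasurable g (volume.restrict (Siegel m)))
    (hf : ∫⁻ z in Siegel m, ‖f z‖ₑ ^ 2 < ⊤) (hg : ∫⁻ z in Siegel m, ‖g z‖ₑ ^ 2 < ⊤) :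
    ∫⁻ z in Siegel m, ∫⁻ w in Siegel m, ‖g z‖ₑ * ‖f w‖ₑ * ‖sK (m + 1) z w‖ₑ < ⊤ := by
  obtain ⟨C, hC, hschur⟩ := exists_lintegral_mul_sK_le m
  have hρ := (continuous_srho (m := m)).measurable
  have hU := measurableSet_Siegel m
  refine (setLIntegral_mono' hU fun z hz => (lintegral_mul_sK_le_add f g hz).trans
    (add_le_add_left (hschur g z hz) _)).trans_lt ?_
  rw [lintegral_add_left' (by fun_prop), lintegral_const_mul' _ _ hC, lintegral_lintegral_swap]
  · refine ENNReal.add_lt_top.2 ⟨ENNReal.mul_lt_top hC.lt_top hg, ?_⟩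
    refine (setLIntegral_mono' hU (hschur f)).trans_lt ?_
    rw [lintegral_const_mul' _ _ hC]
    exact ENNReal.mul_lt_top hC.lt_top hf
  · have hf2 := hfm.comp_snd (μ := volume.restrict (Siegel m))
    have hKs : Measurable fun q : SPoint m × SPoint m => ‖sK (m + 1) q.2 q.1‖ₑ :=
      ((measurable_sK m).comp measurable_swap).enorm
    unfold Function.uncurry
    refine AEMeasurable.mul ?_ hKs.aemeasurable
    fun_prop

theorem sFinite_restrict_of_lintegral_lt_top {X : Type*} [MeasurableSpace X] {μ : Measure X}
    {s : Set X} (hs : MeasurableSet s) {h : X → ENNReal} (hm : Measurable h)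
    (hpos : ∀ x ∈ s, h x ≠ 0) (hfin : ∀ x, h x ≠ ⊤) (h_int : ∫⁻ x in s, h x ∂μ < ⊤) :
    SFinite (μ.restrict s) := by
  have : IsFiniteMeasure ((μ.restrict s).withDensity h) := isFiniteMeasure_withDensity h_int.ne
  rw [← withDensity_inv_same hm ((ae_restrict_iff' hs).2 (.of_forall hpos))
    (.of_forall hfin)]
  infer_instance

/-- The Carleson condition for `A¹`, extended to all holomorphic functions. -/
theorem lintegral_enorm_le_of_carleson {m : ℕ} {μ : Measure (SPoint m)} {C : ℝ} (hC : 0 < C)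
    (hμ : ∀ f : SPoint m → ℂ, MemAp (m + 1) 1 f →
      ∫⁻ z in Siegel m, ENNReal.ofReal ‖f z‖ ∂μ ≤
        ENNReal.ofReal C * ∫⁻ z in Siegel m, ENNReal.ofReal ‖f z‖)
    {F : SPoint m → ℂ} (hF : DifferentiableOn ℂ F (Siegel m)) :
    ∫⁻ z in Siegel m, ‖F z‖ₑ ∂μ ≤ ENNReal.ofReal C * ∫⁻ z in Siegel m, ‖F z‖ₑ := by
  rcases eq_top_or_lt_top (∫⁻ z in Siegel m, ‖F z‖ₑ) with h | h
  · rw [h, ENNReal.mul_top (by simpa using hC)]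
    exact le_top
  · simp only [← ofReal_norm]
    refine hμ F ⟨hF, ?_⟩
    have hi : IntegrableOn F (Siegel m) :=
      ⟨hF.continuousOn.aestronglyMeasurable (measurableSet_Siegel m), h⟩
    simp only [Real.rpow_one]
    exact hi.norm

theorem lintegral_enorm_mul_enorm_lt_top {m : ℕ} {f g : SPoint m → ℂ}
    (hfm : AEMeasurable f (volume.restrict (Siegel m)))
    (hf : ∫⁻ z in Siegel m, ‖f z‖ₑ ^ 2 < ⊤) (hg : ∫⁻ z in Siegel m, ‖g z‖ₑ ^ 2 < ⊤) :
    ∫⁻ z in Siegel m, ‖f z * g z‖ₑ < ⊤ := by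
  have h : ∀ z, ‖f z * g z‖ₑ ≤ ‖f z‖ₑ ^ 2 + ‖g z‖ₑ ^ 2 := fun z => by
    have := enorm_mul_enorm_le (x := f z) (y := g z) one_pos one_pos
    simpa [enorm_mul] using this
  refine (lintegral_mono h).trans_lt ?_
  rw [lintegral_add_left' (by fun_prop)]
  exact ENNReal.add_lt_top.2 ⟨hf, hg⟩

theorem integral_Siegel_reproducing_conj {m : ℕ} {w : SPoint m} (hw : w ∈ Siegel m)
    {g : SPoint m → ℂ} (hg : DifferentiableOn ℂ g (Siegel m))
    (h_int : IntegrableOn (fun z : SPoint m => sK (m + 1) z w * (starRingEnd ℂ) (g z))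
      (Siegel m)) :
    ∫ z in Siegel m, sK (m + 1) z w * (starRingEnd ℂ) (g z) = (starRingEnd ℂ) (g w) := by
  have h : ∀ z : SPoint m, sK (m + 1) z w * (starRingEnd ℂ) (g z)
      = (starRingEnd ℂ) (sK (m + 1) w z * g z) := fun z => by rw [map_mul, sK_conj]
  simp only [h] at h_int ⊢
  rw [integral_conj, integral_Siegel_reproducing hw hg]
  simpa [IntegrableOn] using Complex.conjCLE.toContinuousLinearMap.integrable_comp h_int

theorem integrable_prod_sK_mul {m : ℕ} {ν : Measure (SPoint m)} [SFinite ν]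
    {c : ENNReal} (hc : c ≠ ⊤)
    (hν : ∀ F : SPoint m → ℂ, DifferentiableOn ℂ F (Siegel m) →
      ∫⁻ z, ‖F z‖ₑ ∂ν ≤ c * ∫⁻ z in Siegel m, ‖F z‖ₑ)
    {f g : SPoint m → ℂ} (hfd : DifferentiableOn ℂ f (Siegel m))
    (hfν : AEStronglyMeasurable f ν)
    (hfm : AEMeasurable f (volume.restrict (Siegel m)))
    (hgm : AEStronglyMeasurable g (volume.restrict (Siegel m)))
    (hf : ∫⁻ z in Siegel m, ‖f z‖ₑ ^ 2 < ⊤) (hg : ∫⁻ z in Siegel m, ‖g z‖ₑ ^ 2 < ⊤) :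
    Integrable (fun q : SPoint m × SPoint m =>
      sK (m + 1) q.1 q.2 * f q.2 * (starRingEnd ℂ) (g q.1))
      ((volume.restrict (Siegel m)).prod ν) := by
  have hm : AEStronglyMeasurable (fun q : SPoint m × SPoint m =>
      sK (m + 1) q.1 q.2 * f q.2 * (starRingEnd ℂ) (g q.1))
      ((volume.restrict (Siegel m)).prod ν) :=
    ((measurable_sK m).aestronglyMeasurable.mul hfν.comp_snd).mul
      (Complex.continuous_conj.comp_aestronglyMeasurable hgm.comp_fst)
  refine ⟨hm, ?_⟩
  rw [HasFiniteIntegral, lintegral_prod _ hm.enorm]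
  refine lt_of_le_of_lt ?_ (ENNReal.mul_lt_top hc.lt_top
    (lintegral_lintegral_sK_lt_top hfm hgm.aemeasurable hf hg))
  rw [← lintegral_const_mul' _ _ hc]
  refine setLIntegral_mono' (measurableSet_Siegel m) fun z hz => ?_
  have h := hν (fun w => sK (m + 1) w z * f w) ((differentiableOn_sK hz).mul hfd)
  have e1 : ∀ w, ‖sK (m + 1) z w * f w * (starRingEnd ℂ) (g z)‖ₑ
      = ‖g z‖ₑ * ‖sK (m + 1) w z * f w‖ₑ := fun w => by
    rw [enorm_mul, enorm_mul, enorm_mul, enorm_sK_comm z w, ← ofReal_norm (starRingEnd ℂ (g z)),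
      RCLike.norm_conj, ofReal_norm, mul_comm]
  have e2 : ∀ w, ‖g z‖ₑ * ‖f w‖ₑ * ‖sK (m + 1) z w‖ₑ
      = ‖g z‖ₑ * ‖sK (m + 1) w z * f w‖ₑ := fun w => by
    rw [enorm_mul, enorm_sK_comm z w]
    ring
  simp only [e1, e2]
  rw [lintegral_const_mul' _ _ enorm_ne_top, lintegral_const_mul' _ _ enorm_ne_top]
  calc _ ≤ ‖g z‖ₑ * (c * ∫⁻ w in Siegel m, ‖sK (m + 1) w z * f w‖ₑ) := by gcongr
    _ = _ := by ring

/-- `⟨T_μ f, g⟩ = ∫_𝒰 f ḡ dμ` for `f ∈ 𝒮_α`, `g ∈ 𝒮_γ`, with both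
sides absolutely convergent. -/
theorem toeplitz_duality_identity (n : ℕ) (hn : 1 ≤ n) (p : ℝ) (hp : 1 < p)
    (α γ : ℝ) (hα1 : (n : ℝ) + 1 / p < α) (hα2 : α < (n : ℝ) + 1)
    (hγ : (n : ℝ) + (p - 1) / p < γ)
    (μ : Measure (SPoint (n - 1)))
    (hμM : ∃ α₀ : ℝ, 0 < α₀ ∧
      ∫⁻ w in Siegel (n - 1),
        ENNReal.ofReal (‖w.2 + Complex.I‖ ^ (-α₀)) ∂μ < ⊤)
    (hμC : ∃ C : ℝ, 0 < C ∧ ∀ f : SPoint (n - 1) → ℂ, MemAp n 1 f →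
      ∫⁻ z in Siegel (n - 1), ENNReal.ofReal (‖f z‖) ∂μ ≤
        ENNReal.ofReal C * ∫⁻ z in Siegel (n - 1), ENNReal.ofReal (‖f z‖))
    (f g : SPoint (n - 1) → ℂ) (hf : SAlpha n α f) (hg : SAlpha n γ g) :
    IntegrableOn
        (fun z => (∫ w in Siegel (n - 1), sK n z w * f w ∂μ) * (starRingEnd ℂ) (g z))
        (Siegel (n - 1)) volume ∧
      IntegrableOn (fun w => f w * (starRingEnd ℂ) (g w)) (Siegel (n - 1)) μ ∧
      ∫ z in Siegel (n - 1),
          (∫ w in Siegel (n - 1), sK n z w * f w ∂μ) * (starRingEnd ℂ) (g z) =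
        ∫ w in Siegel (n - 1), f w * (starRingEnd ℂ) (g w) ∂μ := by
  obtain ⟨m, rfl⟩ : ∃ m, n = m + 1 := ⟨n - 1, by omega⟩
  change Measure (SPoint m) at μ
  change SPoint m → ℂ at f
  change SPoint m → ℂ at g
  change IntegrableOn (fun z : SPoint m =>
        (∫ w in Siegel m, sK (m + 1) z w * f w ∂μ) * (starRingEnd ℂ) (g z)) (Siegel m) volume ∧
      IntegrableOn (fun w => f w * (starRingEnd ℂ) (g w)) (Siegel m) μ ∧
      ∫ z in Siegel m, (∫ w in Siegel m, sK (m + 1) z w * f w ∂μ) * (starRingEnd ℂ) (g z) =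
        ∫ w in Siegel m, f w * (starRingEnd ℂ) (g w) ∂μ
  have hp1 : 0 < 1 / p := by positivity
  have hp2 : 0 < (p - 1) / p := div_pos (by linarith) (by linarith)
  push_cast at hα1 hγ
  have hU := measurableSet_Siegel m
  have hfL := hf.lintegral_enorm_sq_lt_top (by linarith)
  have hgL := hg.lintegral_enorm_sq_lt_top (by linarith)
  have hfd : DifferentiableOn ℂ f (Siegel m) := hf.1
  have hgd : DifferentiableOn ℂ g (Siegel m) := hg.1
  have hfm (ν : Measure (SPoint m)) : AEStronglyMeasurable f (ν.restrict (Siegel m)) :=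
    hfd.continuousOn.aestronglyMeasurable hU
  have hgm (ν : Measure (SPoint m)) : AEStronglyMeasurable g (ν.restrict (Siegel m)) :=
    hgd.continuousOn.aestronglyMeasurable hU
  obtain ⟨α₀, -, hα₀⟩ := hμM
  obtain ⟨C, hC, hCμ⟩ := hμC
  have hcarleson := fun F hF => lintegral_enorm_le_of_carleson (F := F) hC hCμ hF
  have : SFinite (μ.restrict (Siegel m)) := by
    refine sFinite_restrict_of_lintegral_lt_top hU (by fun_prop) (fun w hw => ?_)
      (fun w => ENNReal.ofReal_ne_top) hα₀
    have : 0 < ‖w.2 + Complex.I‖ := one_pos.trans_le (one_le_norm_add_I hw)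
    rw [Ne, ENNReal.ofReal_eq_zero, not_le]
    positivity
  have hH := integrable_prod_sK_mul (ν := μ.restrict (Siegel m)) ENNReal.ofReal_ne_top hcarleson
    hfd (hfm μ) (hfm volume).aemeasurable (hgm volume) hfL hgL
  refine ⟨?_, ?_, ?_⟩
  · have := hH.integral_prod_left
    simpa only [IntegrableOn, integral_mul_const] using this
  · refine ⟨(hfm μ).mul (Complex.continuous_conj.comp_aestronglyMeasurable (hgm μ)), ?_⟩
    have h := (hcarleson _ (hfd.mul hgd)).trans_lt (ENNReal.mul_lt_top ENNReal.ofReal_lt_top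
      (lintegral_enorm_mul_enorm_lt_top (hfm volume).aemeasurable hfL hgL))
    rw [HasFiniteIntegral]
    refine lt_of_eq_of_lt (lintegral_congr fun w => ?_) h
    rw [Pi.mul_apply, enorm_mul, enorm_mul, ← ofReal_norm (starRingEnd ℂ (g w)),
      RCLike.norm_conj, ofReal_norm]
  · have hswap := integral_integral_swap (f := fun z w : SPoint m =>
      sK (m + 1) z w * f w * (starRingEnd ℂ) (g z)) hH
    simp only [integral_mul_const] at hswap
    rw [hswap]
    refine integral_congr_ae ?_
    filter_upwards [hH.prod_left_ae, ae_restrict_mem hU] with w hw hwU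
    rcases eq_or_ne (f w) 0 with h0 | h0
    · simp [h0]
    · have hcomm : ∀ z, sK (m + 1) z w * f w * (starRingEnd ℂ) (g z)
          = f w * (sK (m + 1) z w * (starRingEnd ℂ) (g z)) := fun z => by ring
      simp only [hcomm] at hw ⊢
      rw [integral_const_mul, integral_Siegel_reproducing_conj hwU hgd
        ((integrable_const_mul_iff h0.isUnit _).1 hw)]
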